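/- (Four-term recurrence relation) Assume τ_k^{s,t} ≠ 0 and σ̃_k^{s,t} ≠ 0 for all k. Then for every n ≥ 2 the polynomial identity x·(P_n^{s,t}(x) + a_n^{s,t} P_{n−1}^{s,t}(x)) = P_{n+1}^{s,t}(x) + (a_n^{s,t} − b_n^{s,t}) P_n^{s,t}(x) + (−c_n^{s,t} + a_n^{s,t} b_{n−1}^{s,t}) P_{n−1}^{s,t}(x) − a_n^{s,t} c_{n−1}^{s,t} P_{n−2}^{s,t}(x) holds, where a_n^{s,t} = −σ̃_n^{s,t}τ_{n−1}^{s,t}/(σ̃_{n−1}^{s,t}τ_n^{s,t}), b_n^{s,t} = p_{n+1}^{s,t} − p_n^{s,t} with p_n^{s,t} = −τ̃_n^{s,t}/τ_n^{s,t}, and c_n^{s,t} = τ_{n−1}^{s,t}τ_{n+1}^{s,t}/(τ_n^{s,t})². -/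

import Mathlib

open MeasureTheory

/-- Bimoments `m_{i,j}^{s,t}` of the Cauchy-Jacobi weight. -/
noncomputable def mom (s t i j : ℕ) : ℝ :=
  ∫ p in (Set.Ioo (0:ℝ) 1 ×ˢ Set.Ioo (0:ℝ) 1),
    (p.1 ^ (s + i) * p.2 ^ (s + j) / (p.1 + p.2)) *
      ((1 - p.1) / (1 + p.1)) ^ t * ((1 - p.2) / (1 + p.2)) ^ t

/-- Single moments `φ_i^{s,t} = L_{s,t}(x^i)`. -/
noncomputable def phi (s t i : ℕ) : ℝ :=
  Real.sqrt 2 * ∫ x in Set.Ioo (0:ℝ) 1,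
    (x ^ (s + i) / (1 + x)) * ((1 - x) / (1 + x)) ^ t

/-- Single moments `m_i^{s,t}`. -/
noncomputable def momS (s t i : ℕ) : ℝ :=
  ∫ x in Set.Ioo (0:ℝ) 1, x ^ (s + i) * ((1 - x) / (1 + x)) ^ t

/-- `τ_n^{s,t} = det(m_{i,j}^{s,t})_{i,j=0}^{n-1}` (with `τ_0^{s,t} = 1`). -/
noncomputable def tau (s t n : ℕ) : ℝ :=
  Matrix.det (Matrix.of fun i j : Fin n => mom s t i j)

/-- `ξ_n^{s,t} = det(m_{i,j+1}^{s,t})_{i,j=0}^{n-1}` (with `ξ_0^{s,t} = 1`). -/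
noncomputable def xi (s t n : ℕ) : ℝ :=
  Matrix.det (Matrix.of fun i j : Fin n => mom s t i ((j : ℕ) + 1))

/-- `σ_n^{s,t}`: determinant of the `(n+1)×(n+1)` matrix with first `n` columns the
bimoments and last column `(φ_0^{s,t},…,φ_n^{s,t})`. -/
noncomputable def sig (s t n : ℕ) : ℝ :=
  Matrix.det (Matrix.of fun i j : Fin (n + 1) =>
    if (j : ℕ) < n then mom s t i j else phi s t i)

/-- `ψ_n^{s,t}`: like `σ_n^{s,t}` but with shifted bimoments `m_{i,j+1}^{s,t}`. -/
noncomputable def psi (s t n : ℕ) : ℝ :=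
  Matrix.det (Matrix.of fun i j : Fin (n + 1) =>
    if (j : ℕ) < n then mom s t i ((j : ℕ) + 1) else phi s t i)

/-- `σ̃_n^{s,t}`: determinant of the `(n+1)×(n+1)` matrix with first `n` columns the
bimoments and last column the single moments `(m_0^{s,t},…,m_n^{s,t})`. -/
noncomputable def sigT (s t n : ℕ) : ℝ :=
  Matrix.det (Matrix.of fun i j : Fin (n + 1) =>
    if (j : ℕ) < n then mom s t i j else momS s t i)

/-- `τ̃_n^{s,t}`: determinant of the `n×n` matrix whose rows are the bimoment rows
`i = 0,…,n−2,n`. -/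
noncomputable def tauT (s t n : ℕ) : ℝ :=
  Matrix.det (Matrix.of fun i j : Fin n =>
    mom s t (if (i : ℕ) < n - 1 then (i : ℕ) else n) j)

/-- The monic Cauchy-Jacobi orthogonal polynomial `P_n^{s,t}` (as a real function). -/
noncomputable def P (s t n : ℕ) (x : ℝ) : ℝ :=
  (1 / tau s t n) * Matrix.det (Matrix.of fun i j : Fin (n + 1) =>
    if (j : ℕ) < n then mom s t i j else x ^ (i : ℕ))

/-- The adjacent monic polynomial `Q_n^{s,t}` (as a real function). -/
noncomputable def Q (s t n : ℕ) (x : ℝ) : ℝ :=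
  (1 / xi s t n) * Matrix.det (Matrix.of fun i j : Fin (n + 1) =>
    if (j : ℕ) < n then mom s t i ((j : ℕ) + 1) else x ^ (i : ℕ))

/-- The auxiliary monic polynomial `R_n^{s,t}` (as a real function): first column
`(φ_0,…,φ_n)`, next `n−1` columns the bimoments `m_{i,j}` for `j = 0,…,n−2`,
last column `(1,x,…,x^n)`, normalized by `(−1)^{n−1}/σ_{n−1}^{s,t}`. -/
noncomputable def R (s t n : ℕ) (x : ℝ) : ℝ :=
  ((-1 : ℝ) ^ (n - 1) / sig s t (n - 1)) *
    Matrix.det (Matrix.of fun i j : Fin (n + 1) =>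
      if (j : ℕ) = 0 then phi s t i
      else if (j : ℕ) < n then mom s t i ((j : ℕ) - 1) else x ^ (i : ℕ))

/-- The two-parameter deformed Cauchy inner product `⟨f,g⟩_{s,t}` on real functions. -/
noncomputable def innerF (s t : ℕ) (f g : ℝ → ℝ) : ℝ :=
  ∫ p in (Set.Ioo (0:ℝ) 1 ×ˢ Set.Ioo (0:ℝ) 1),
    (p.1 ^ s * p.2 ^ s / (p.1 + p.2)) * f p.1 * g p.2 *
      ((1 - p.1) / (1 + p.1)) ^ t * ((1 - p.2) / (1 + p.2)) ^ t

/-- The two-parameter deformed Cauchy inner product on real polynomials. -/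
noncomputable def innerP (s t : ℕ) (f g : Polynomial ℝ) : ℝ :=
  innerF s t (fun x => f.eval x) (fun y => g.eval y)

/-- The linear functional `L_{s,t}` on real functions. -/
noncomputable def LF (s t : ℕ) (f : ℝ → ℝ) : ℝ :=
  Real.sqrt 2 * ∫ x in Set.Ioo (0:ℝ) 1,
    (x ^ s / (1 + x)) * f x * ((1 - x) / (1 + x)) ^ t

/-- The linear functional `L_{s,t}` on real polynomials. -/
noncomputable def LP (s t : ℕ) (f : Polynomial ℝ) : ℝ := LF s t (fun x => f.eval x)

/-- `p_n^{s,t} = −τ̃_n^{s,t}/τ_n^{s,t}`, the coefficient of `x^{n-1}` in `P_n^{s,t}`. -/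
noncomputable def pcoef (s t n : ℕ) : ℝ := -(tauT s t n) / tau s t n

/-- `a_n^{s,t} = −σ̃_n^{s,t}τ_{n−1}^{s,t}/(σ̃_{n−1}^{s,t}τ_n^{s,t})`. -/
noncomputable def acoef (s t n : ℕ) : ℝ :=
  -(sigT s t n * tau s t (n - 1)) / (sigT s t (n - 1) * tau s t n)

/-- `b_n^{s,t} = p_{n+1}^{s,t} − p_n^{s,t}`. -/
noncomputable def bcoef (s t n : ℕ) : ℝ := pcoef s t (n + 1) - pcoef s t n

/-- `c_n^{s,t} = τ_{n−1}^{s,t}τ_{n+1}^{s,t}/(τ_n^{s,t})²`. -/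
noncomputable def ccoef (s t n : ℕ) : ℝ :=
  tau s t (n - 1) * tau s t (n + 1) / (tau s t n) ^ 2

open Polynomial in
/-- The bilinear form on real polynomials with `⟨X ^ i, X ^ j⟩ = m i j`. -/
noncomputable def momentForm (m : ℕ → ℕ → ℝ) : ℝ[X] →ₗ[ℝ] ℝ[X] →ₗ[ℝ] ℝ :=
  (basisMonomials ℝ).constr ℝ fun i => (basisMonomials ℝ).constr ℝ fun j => m i j

open Polynomial in
/-- The linear functional on real polynomials with `X ^ i ↦ μ i`. -/
noncomputable def momentFunctional (μ : ℕ → ℝ) : ℝ[X] →ₗ[ℝ] ℝ :=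
  (basisMonomials ℝ).constr ℝ μ

/-- The leading `n × n` minor of a bimoment matrix. -/
noncomputable def momentDet (m : ℕ → ℕ → ℝ) (n : ℕ) : ℝ :=
  Matrix.det (Matrix.of fun i j : Fin n => m i j)

/-- The bimoment determinant bordered by a last column `v`. -/
noncomputable def borderedDet (m : ℕ → ℕ → ℝ) (n : ℕ) (v : ℕ → ℝ) : ℝ :=
  Matrix.det (Matrix.of fun i j : Fin (n + 1) => if (j : ℕ) < n then m i j else v i)

/-- The cofactors of the last column of a bordered bimoment determinant. -/
noncomputable def borderedCofactor (m : ℕ → ℕ → ℝ) (n : ℕ) (i : Fin (n + 1)) : ℝ :=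
  (-1) ^ ((i : ℕ) + n) * Matrix.det (Matrix.of fun a b : Fin n => m (i.succAbove a) b)

open Polynomial in
/-- The monic orthogonal polynomial of degree `n` of a bimoment matrix. -/
noncomputable def orthoPoly (m : ℕ → ℕ → ℝ) (n : ℕ) : ℝ[X] :=
  ∑ i : Fin (n + 1), (borderedCofactor m n i / momentDet m n) • X ^ (i : ℕ)

section Abstract

open Polynomial

variable {m : ℕ → ℕ → ℝ} {μ : ℕ → ℝ}

lemma momentForm_X_pow (i j : ℕ) : momentForm m (X ^ i) (X ^ j) = m i j := by
  have h (k : ℕ) : (X ^ k : ℝ[X]) = basisMonomials ℝ k := by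
    simp [X_pow_eq_monomial]
  simp only [momentForm, h, Module.Basis.constr_basis]

lemma momentFunctional_X_pow (i : ℕ) : momentFunctional μ (X ^ i) = μ i := by
  have h (k : ℕ) : (X ^ k : ℝ[X]) = basisMonomials ℝ k := by
    simp [X_pow_eq_monomial]
  simp only [momentFunctional, h, Module.Basis.constr_basis]

lemma momentForm_comm (hm : ∀ i j, m i j = m j i) (f g : ℝ[X]) :
    momentForm m f g = momentForm m g f := by
  have h : momentForm m = (momentForm m).flip := by
    refine (basisMonomials ℝ).ext fun i => (basisMonomials ℝ).ext fun j => ?_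
    simp [← X_pow_eq_monomial, momentForm_X_pow, hm i j]
  exact congrFun (congrArg DFunLike.coe (LinearMap.congr_fun h f)) g

lemma momentForm_X_mul_add (hmμ : ∀ i j, m (i + 1) j + m i (j + 1) = μ i * μ j) (f g : ℝ[X]) :
    momentForm m (X * f) g + momentForm m f (X * g) =
      momentFunctional μ f * momentFunctional μ g := by
  induction f using Polynomial.induction_on' with
  | add p q hp hq => simp only [mul_add, map_add, LinearMap.add_apply, add_mul]; linarith
  | monomial i a =>
    induction g using Polynomial.induction_on' with
    | add p q hp hq => simp only [mul_add, map_add]; linarith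
    | monomial j b =>
      simp only [← smul_X_eq_monomial, mul_smul_comm, ← pow_succ', map_smul, LinearMap.smul_apply,
        momentForm_X_pow, momentFunctional_X_pow, smul_eq_mul]
      linear_combination a * b * hmμ i j

lemma borderedDet_eq_sum (n : ℕ) (v : ℕ → ℝ) :
    borderedDet m n v = ∑ i, borderedCofactor m n i * v i := by
  rw [borderedDet, Matrix.det_succ_column _ (Fin.last n)]
  refine Finset.sum_congr rfl fun i _ => ?_
  simp only [borderedCofactor, Matrix.of_apply, Fin.val_last, lt_irrefl, if_false]
  have h : (Matrix.of fun i j : Fin (n + 1) => if (j : ℕ) < n then m i j else v i).submatrix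
      i.succAbove (Fin.last n).succAbove = Matrix.of fun a b : Fin n => m (i.succAbove a) b := by
    ext a b
    simp
  rw [h]
  ring

lemma borderedDet_column_of_lt {n j : ℕ} (hj : j < n) : borderedDet m n (m · j) = 0 := by
  refine Matrix.det_zero_of_column_eq (i := ⟨j, by omega⟩) (j := Fin.last n)
    (by simp [Fin.ext_iff]; omega) fun k => ?_
  simp [hj]

lemma borderedDet_column_self (n : ℕ) : borderedDet m n (m · n) = momentDet m (n + 1) := by
  unfold borderedDet momentDet
  congr 1
  ext i j
  simp only [Matrix.of_apply]
  split_ifs with h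
  · rfl
  · rw [show (j : ℕ) = n by omega]

lemma borderedCofactor_last (n : ℕ) : borderedCofactor m n (Fin.last n) = momentDet m n := by
  simp [borderedCofactor, momentDet, ← two_mul]

lemma map_orthoPoly (ℓ : ℝ[X] →ₗ[ℝ] ℝ) (n : ℕ) :
    ℓ (orthoPoly m n) = borderedDet m n (fun i => ℓ (X ^ i)) / momentDet m n := by
  simp only [orthoPoly, map_sum, map_smul, smul_eq_mul, borderedDet_eq_sum, Finset.sum_div]
  exact Finset.sum_congr rfl fun i _ => by ring

lemma coeff_orthoPoly (n : ℕ) (i : Fin (n + 1)) :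
    (orthoPoly m n).coeff i = borderedCofactor m n i / momentDet m n := by
  simp [orthoPoly, coeff_X_pow, Fin.val_inj]

lemma coeff_orthoPoly_self {n : ℕ} (h : momentDet m n ≠ 0) : (orthoPoly m n).coeff n = 1 := by
  have := coeff_orthoPoly (m := m) n (Fin.last n)
  rwa [borderedCofactor_last, div_self h] at this

lemma coeff_orthoPoly_of_lt {n k : ℕ} (h : n < k) : (orthoPoly m n).coeff k = 0 := by
  simp only [orthoPoly, finsetSum_coeff, coeff_smul, coeff_X_pow, smul_eq_mul]
  exact Finset.sum_eq_zero fun i _ => by rw [if_neg (by omega), mul_zero]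

lemma momentForm_orthoPoly_X_pow_of_lt {n j : ℕ} (hj : j < n) :
    momentForm m (orthoPoly m n) (X ^ j) = 0 := by
  have := map_orthoPoly (m := m) ((momentForm m).flip (X ^ j)) n
  simpa [momentForm_X_pow, borderedDet_column_of_lt hj] using this

lemma momentForm_orthoPoly_X_pow_self (n : ℕ) :
    momentForm m (orthoPoly m n) (X ^ n) = momentDet m (n + 1) / momentDet m n := by
  have := map_orthoPoly (m := m) ((momentForm m).flip (X ^ n)) n
  simpa [momentForm_X_pow, borderedDet_column_self] using this

/-- A linear functional vanishing on `X ^ j` for `j < n` only sees the coefficient of `X ^ n` of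
a polynomial of degree at most `n`. -/
lemma map_eq_coeff_mul {ℓ : ℝ[X] →ₗ[ℝ] ℝ} {n : ℕ} (hℓ : ∀ j < n, ℓ (X ^ j) = 0) {g : ℝ[X]}
    (hg : ∀ k, n < k → g.coeff k = 0) : ℓ g = g.coeff n * ℓ (X ^ n) := by
  have hdeg : g.natDegree < n + 1 := by
    by_contra! h
    have h0 := hg _ h
    rw [coeff_natDegree, leadingCoeff_eq_zero] at h0
    simp [h0] at h
  conv_lhs => rw [as_sum_range' g (n + 1) hdeg]
  simp only [← smul_X_eq_monomial, map_sum, map_smul, smul_eq_mul]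
  rw [Finset.sum_range_succ, Finset.sum_eq_zero, zero_add]
  intro j hj
  rw [hℓ j (Finset.mem_range.1 hj), mul_zero]

lemma momentForm_orthoPoly {n : ℕ} {g : ℝ[X]} (hg : ∀ k, n < k → g.coeff k = 0) :
    momentForm m (orthoPoly m n) g = g.coeff n * (momentDet m (n + 1) / momentDet m n) := by
  rw [map_eq_coeff_mul (fun j hj => momentForm_orthoPoly_X_pow_of_lt hj) hg,
    momentForm_orthoPoly_X_pow_self]

lemma eq_zero_of_momentForm_X_pow {n : ℕ} (h : momentDet m n ≠ 0) {g : ℝ[X]}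
    (hg : ∀ k, n ≤ k → g.coeff k = 0) (hB : ∀ j < n, momentForm m g (X ^ j) = 0) : g = 0 := by
  have hsum : g = ∑ i : Fin n, g.coeff i • X ^ (i : ℕ) := by
    ext k
    simp only [finsetSum_coeff, coeff_smul, coeff_X_pow, smul_eq_mul, mul_ite, mul_one, mul_zero]
    by_cases hk : k < n
    · rw [Finset.sum_eq_single ⟨k, hk⟩] <;> simp +contextual [Fin.ext_iff, eq_comm]
    · rw [hg k (by omega), Finset.sum_eq_zero fun i _ => if_neg (by omega)]
  have hv : (fun i : Fin n => g.coeff i) = 0 := by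
    refine Matrix.eq_zero_of_vecMul_eq_zero h (funext fun j => ?_)
    have := hB j j.2
    rw [hsum] at this
    simpa [Matrix.vecMul, dotProduct, momentForm_X_pow] using this
  ext k
  by_cases hk : k < n
  · exact congrFun hv ⟨k, hk⟩
  · exact hg k (by omega)

/-- Twice the diagonal term `⟨P, X P⟩` is the square of the single moment of `P`, which determines
the difference of consecutive subleading coefficients. -/
lemma subleading_diff_mul (hm : ∀ i j, m i j = m j i)
    (hmμ : ∀ i j, m (i + 1) j + m i (j + 1) = μ i * μ j) (h : ∀ k, momentDet m k ≠ 0) (n : ℕ) :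
    2 * (((orthoPoly m (n + 2)).coeff (n + 1) - (orthoPoly m (n + 1)).coeff n) *
      (momentDet m (n + 2) / momentDet m (n + 1))) =
      - momentFunctional μ (orthoPoly m (n + 1)) ^ 2 := by
  set p := orthoPoly m (n + 1)
  set q := orthoPoly m (n + 2)
  have hX := momentForm_X_mul_add hmμ p p
  rw [momentForm_comm hm (X * p)] at hX
  have hqp : momentForm m p q = 0 := by
    rw [momentForm_comm hm, momentForm_orthoPoly fun k hk => coeff_orthoPoly_of_lt (by omega),
      coeff_orthoPoly_of_lt (by omega), zero_mul]
  have hpe : momentForm m p (X * p - q) =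
      (X * p - q).coeff (n + 1) * (momentDet m (n + 2) / momentDet m (n + 1)) := by
    refine momentForm_orthoPoly fun k hk => ?_
    obtain ⟨k, rfl⟩ := Nat.exists_eq_add_of_le' (Nat.succ_le_of_lt hk)
    rcases k with _ | k
    · rw [coeff_sub, show 0 + (n + 1).succ = n + 1 + 1 by omega, coeff_X_mul,
        coeff_orthoPoly_self (h _), coeff_orthoPoly_self (h _), sub_self]
    · rw [coeff_sub, show k + 1 + (n + 1).succ = k + 1 + (n + 1) + 1 by omega, coeff_X_mul,
        coeff_orthoPoly_of_lt (by omega), coeff_orthoPoly_of_lt (by omega), sub_self]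
  rw [map_sub, hqp, coeff_sub, coeff_X_mul] at hpe
  linear_combination (-1) * hX + 2 * hpe

lemma orthoPoly_four_term (hm : ∀ i j, m i j = m j i)
    (hmμ : ∀ i j, m (i + 1) j + m i (j + 1) = μ i * μ j) (h : ∀ k, momentDet m k ≠ 0)
    (n : ℕ) (a : ℝ)
    (ha : momentFunctional μ (orthoPoly m (n + 2)) +
      a * momentFunctional μ (orthoPoly m (n + 1)) = 0) :
    X * (orthoPoly m (n + 2) + a • orthoPoly m (n + 1)) =
      orthoPoly m (n + 3) +
        (a - ((orthoPoly m (n + 3)).coeff (n + 2) - (orthoPoly m (n + 2)).coeff (n + 1))) •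
          orthoPoly m (n + 2) +
        (-(momentDet m (n + 1) * momentDet m (n + 3) / momentDet m (n + 2) ^ 2) +
          a * ((orthoPoly m (n + 2)).coeff (n + 1) - (orthoPoly m (n + 1)).coeff n)) •
          orthoPoly m (n + 1) -
        (a * (momentDet m n * momentDet m (n + 2) / momentDet m (n + 1) ^ 2)) •
          orthoPoly m n := by
  set p3 := orthoPoly m (n + 3) with hp3
  set p2 := orthoPoly m (n + 2) with hp2
  set p1 := orthoPoly m (n + 1) with hp1
  set p0 := orthoPoly m n with hp0
  have h3 := h (n + 3)
  have h2 := h (n + 2)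
  have h1 := h (n + 1)
  have h0 := h n
  have hb := subleading_diff_mul hm hmμ h n
  rw [← hp1, ← hp2] at hb
  set L := momentFunctional μ
  have hf (g : ℝ[X]) : momentForm m (X * (p2 + a • p1)) g =
      -(momentForm m p2 (X * g) + a * momentForm m p1 (X * g)) := by
    have := momentForm_X_mul_add hmμ (p2 + a • p1) g
    have hL : L (p2 + a • p1) = 0 := by rw [map_add, map_smul, smul_eq_mul, ha]
    rw [hL, zero_mul, map_add _ p2, map_smul _ a p1, LinearMap.add_apply, LinearMap.smul_apply,
      smul_eq_mul] at this
    linarith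
  rw [← sub_eq_zero]
  set b := p3.coeff (n + 2) - p2.coeff (n + 1) with hbdef
  set b' := p2.coeff (n + 1) - p1.coeff n
  set E := X * (p2 + a • p1) - _ with hE
  have hEform (g : ℝ[X]) : momentForm m E g = -(momentForm m p2 (X * g) +
      a * momentForm m p1 (X * g)) - (momentForm m p3 g + (a - b) * momentForm m p2 g +
      (-(momentDet m (n + 1) * momentDet m (n + 3) / momentDet m (n + 2) ^ 2) + a * b') *
        momentForm m p1 g -
      (a * (momentDet m n * momentDet m (n + 2) / momentDet m (n + 1) ^ 2)) *
        momentForm m p0 g) := by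
    rw [hE, map_sub, LinearMap.sub_apply, hf]
    simp only [map_sub, map_add, map_smul, LinearMap.sub_apply, LinearMap.add_apply,
      LinearMap.smul_apply, smul_eq_mul]
  have hdeg : ∀ k, n + 2 ≤ k → E.coeff k = 0 := by
    intro k hk
    obtain ⟨k, rfl⟩ := Nat.exists_eq_add_of_le' hk
    rw [hE, show k + (n + 2) = k + (n + 1) + 1 by omega]
    simp only [coeff_sub, coeff_add, coeff_smul, coeff_X_mul, smul_eq_mul]
    have e0 : p0.coeff (k + (n + 1) + 1) = 0 := coeff_orthoPoly_of_lt (by omega)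
    have e1 : p1.coeff (k + (n + 1) + 1) = 0 := coeff_orthoPoly_of_lt (by omega)
    rw [e0, e1]
    rcases k with _ | _ | k
    · have e2 : p2.coeff (0 + (n + 1) + 1) = 1 := by
        rw [show 0 + (n + 1) + 1 = n + 2 by omega]; exact coeff_orthoPoly_self h2
      have e3 : p1.coeff (0 + (n + 1)) = 1 := by
        rw [zero_add]; exact coeff_orthoPoly_self h1
      rw [e2, e3, hbdef, zero_add, show n + 1 + 1 = n + 2 by omega]
      ring
    · have e2 : p2.coeff (0 + 1 + (n + 1)) = 1 := by
        rw [show 0 + 1 + (n + 1) = n + 2 by omega]; exact coeff_orthoPoly_self h2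
      have e3 : p1.coeff (0 + 1 + (n + 1)) = 0 := coeff_orthoPoly_of_lt (by omega)
      have e4 : p2.coeff (0 + 1 + (n + 1) + 1) = 0 := coeff_orthoPoly_of_lt (by omega)
      have e5 : p3.coeff (0 + 1 + (n + 1) + 1) = 1 := by
        rw [show 0 + 1 + (n + 1) + 1 = n + 3 by omega]; exact coeff_orthoPoly_self h3
      rw [e2, e3, e4, e5]
      ring
    · rw [show p2.coeff (k + 1 + 1 + (n + 1)) = 0 from coeff_orthoPoly_of_lt (by omega),
        show p1.coeff (k + 1 + 1 + (n + 1)) = 0 from coeff_orthoPoly_of_lt (by omega),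
        show p2.coeff (k + 1 + 1 + (n + 1) + 1) = 0 from coeff_orthoPoly_of_lt (by omega),
        show p3.coeff (k + 1 + 1 + (n + 1) + 1) = 0 from coeff_orthoPoly_of_lt (by omega)]
      ring
  have horth : ∀ j < n + 1, momentForm m E (X ^ j) = 0 := by
    intro j hj
    rw [hEform, ← pow_succ']
    have e3 : momentForm m p3 (X ^ j) = 0 := momentForm_orthoPoly_X_pow_of_lt (by omega)
    have e2 : momentForm m p2 (X ^ j) = 0 := momentForm_orthoPoly_X_pow_of_lt (by omega)
    have e2' : momentForm m p2 (X ^ (j + 1)) = 0 := momentForm_orthoPoly_X_pow_of_lt (by omega)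
    have e1 : momentForm m p1 (X ^ j) = 0 := momentForm_orthoPoly_X_pow_of_lt (by omega)
    rw [e3, e2, e2', e1]
    rcases Nat.lt_succ_iff_lt_or_eq.1 hj with hj | rfl
    · have e1' : momentForm m p1 (X ^ (j + 1)) = 0 := momentForm_orthoPoly_X_pow_of_lt (by omega)
      have e0 : momentForm m p0 (X ^ j) = 0 := momentForm_orthoPoly_X_pow_of_lt hj
      rw [e1', e0]
      ring
    · rw [hp1, hp0, momentForm_orthoPoly_X_pow_self, momentForm_orthoPoly_X_pow_self]
      field_simp
      ring
  have hlast : momentForm m E p1 = 0 := by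
    rw [hEform]
    have e21 : momentForm m p2 (X * p1) = momentDet m (n + 3) / momentDet m (n + 2) := by
      rw [hp2, momentForm_orthoPoly, hp1, coeff_X_mul, coeff_orthoPoly_self h1, one_mul]
      intro k hk
      obtain ⟨k, rfl⟩ := Nat.exists_eq_add_of_le' (Nat.succ_le_of_lt hk)
      rw [show k + (n + 2).succ = k + n + 2 + 1 by omega, coeff_X_mul]
      exact coeff_orthoPoly_of_lt (by omega)
    have e11 : momentForm m p1 p1 = momentDet m (n + 2) / momentDet m (n + 1) := by
      rw [hp1, momentForm_orthoPoly fun k hk => coeff_orthoPoly_of_lt hk,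
        coeff_orthoPoly_self h1, one_mul]
    have e3 : momentForm m p3 p1 = 0 := by
      rw [hp3, momentForm_orthoPoly fun k hk => coeff_orthoPoly_of_lt (by omega),
        coeff_orthoPoly_of_lt (by omega), zero_mul]
    have e2 : momentForm m p2 p1 = 0 := by
      rw [hp2, momentForm_orthoPoly fun k hk => coeff_orthoPoly_of_lt (by omega),
        coeff_orthoPoly_of_lt (by omega), zero_mul]
    have e0 : momentForm m p0 p1 = 0 := by
      rw [momentForm_comm hm, hp1,
        momentForm_orthoPoly fun k hk => coeff_orthoPoly_of_lt (by omega),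
        coeff_orthoPoly_of_lt (by omega), zero_mul]
    have eX := momentForm_X_mul_add hmμ p1 p1
    rw [momentForm_comm hm (X * p1)] at eX
    rw [e21, e11, e3, e2, e0]
    have hc : momentDet m (n + 1) * momentDet m (n + 3) / momentDet m (n + 2) ^ 2 *
        (momentDet m (n + 2) / momentDet m (n + 1)) =
        momentDet m (n + 3) / momentDet m (n + 2) := by
      field_simp
    linear_combination hc - a / 2 * eX - a / 2 * hb
  refine eq_zero_of_momentForm_X_pow h2 hdeg fun j hj => ?_
  rcases Nat.lt_succ_iff_lt_or_eq.1 hj with hj | rfl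
  · exact horth j hj
  · rwa [map_eq_coeff_mul horth fun k hk => coeff_orthoPoly_of_lt hk, coeff_orthoPoly_self h1,
      one_mul] at hlast

end Abstract

lemma mom_comm (s t i j : ℕ) : mom s t i j = mom s t j i := by
  unfold mom
  rw [Measure.volume_eq_prod, ← setIntegral_prod_swap]
  refine integral_congr_ae (Filter.Eventually.of_forall fun p => ?_)
  simp only [Prod.fst_swap, Prod.snd_swap]
  rw [add_comm p.2 p.1]
  ring

lemma integrableOn_mom_integrand (s t i j : ℕ) (hij : 0 < i + j) :
    IntegrableOn (fun p : ℝ × ℝ => (p.1 ^ (s + i) * p.2 ^ (s + j) / (p.1 + p.2)) *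
      ((1 - p.1) / (1 + p.1)) ^ t * ((1 - p.2) / (1 + p.2)) ^ t)
      (Set.Ioo (0:ℝ) 1 ×ˢ Set.Ioo (0:ℝ) 1) := by
  refine Measure.integrableOn_of_bounded (M := 1) ?_ ?_ ?_
  · rw [Measure.volume_eq_prod, Measure.prod_prod]
    simp
  · exact Measurable.aestronglyMeasurable (by fun_prop)
  · refine (ae_restrict_mem (measurableSet_Ioo.prod measurableSet_Ioo)).mono ?_
    rintro ⟨x, y⟩ ⟨⟨hx0, hx1⟩, ⟨hy0, hy1⟩⟩
    have hw {u : ℝ} (h0 : 0 < u) (h1 : u < 1) :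
        0 ≤ ((1 - u) / (1 + u)) ^ t ∧ ((1 - u) / (1 + u)) ^ t ≤ 1 := by
      have h : 0 ≤ (1 - u) / (1 + u) := div_nonneg (by linarith) (by linarith)
      exact ⟨pow_nonneg h t, pow_le_one₀ h ((div_le_one (by linarith)).2 (by linarith))⟩
    obtain ⟨hwx, hwx'⟩ := hw hx0 hx1
    obtain ⟨hwy, hwy'⟩ := hw hy0 hy1
    dsimp only at hx0 hx1 hy0 hy1 ⊢
    have hk : x ^ (s + i) * y ^ (s + j) / (x + y) ≤ 1 := by
      rw [div_le_one (by positivity)]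
      rcases Nat.eq_zero_or_pos i with rfl | hi
      · calc x ^ (s + 0) * y ^ (s + j) ≤ 1 * y := by
              gcongr
              · exact pow_le_one₀ hx0.le hx1.le
              · exact pow_le_of_le_one hy0.le hy1.le (by omega)
          _ ≤ x + y := by linarith
      · calc x ^ (s + i) * y ^ (s + j) ≤ x * 1 := by
              gcongr
              · exact pow_le_of_le_one hx0.le hx1.le (by omega)
              · exact pow_le_one₀ hy0.le hy1.le
          _ ≤ x + y := by linarith
    have hk0 : 0 ≤ x ^ (s + i) * y ^ (s + j) / (x + y) := by positivity
    rw [Real.norm_of_nonneg (by positivity)]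
    exact mul_le_one₀ (mul_le_one₀ hk hwx hwx') hwy hwy'

lemma mom_succ_add_mom_succ (s t i j : ℕ) :
    mom s t (i + 1) j + mom s t i (j + 1) = momS s t i * momS s t j := by
  unfold mom momS
  rw [← setIntegral_prod_mul, ← Measure.volume_eq_prod, ← integral_add
    (integrableOn_mom_integrand s t (i + 1) j (by omega))
    (integrableOn_mom_integrand s t i (j + 1) (by omega))]
  refine setIntegral_congr_fun (measurableSet_Ioo.prod measurableSet_Ioo) ?_
  rintro ⟨x, y⟩ ⟨⟨hx0, -⟩, ⟨hy0, -⟩⟩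
  dsimp only at hx0 hy0 ⊢
  have : x + y ≠ 0 := by positivity
  generalize ((1 - x) / (1 + x)) ^ t = u
  generalize ((1 - y) / (1 + y)) ^ t = v
  field_simp
  ring

lemma P_eq_eval_orthoPoly (s t n : ℕ) (x : ℝ) :
    P s t n x = (orthoPoly (mom s t) n).eval x := by
  have := map_orthoPoly (m := mom s t) (Polynomial.leval x) n
  simp only [Polynomial.leval_apply, Polynomial.eval_pow, Polynomial.eval_X] at this
  rw [this, P, one_div_mul_eq_div]
  rfl

lemma momentFunctional_orthoPoly (s t n : ℕ) :
    momentFunctional (momS s t) (orthoPoly (mom s t) n) = sigT s t n / tau s t n := by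
  rw [map_orthoPoly]
  simp only [momentFunctional_X_pow]
  rfl

lemma pcoef_eq_coeff_orthoPoly (s t n : ℕ) :
    pcoef s t (n + 1) = (orthoPoly (mom s t) (n + 1)).coeff n := by
  have := coeff_orthoPoly (m := mom s t) (n + 1) (Fin.last n).castSucc
  simp only [Fin.val_castSucc, Fin.val_last] at this
  rw [this, pcoef, borderedCofactor, Fin.val_castSucc, Fin.val_last, ← add_assoc,
    Odd.neg_one_pow (by rw [← two_mul]; exact ⟨n, rfl⟩), neg_one_mul]
  unfold tauT
  congr 3
  ext a b
  simp only [Matrix.of_apply, Nat.add_sub_cancel]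
  congr 1
  split_ifs with h
  · rw [Fin.succAbove_of_castSucc_lt _ _ (by simpa [Fin.lt_def] using h), Fin.val_castSucc]
  · rw [Fin.succAbove_of_le_castSucc _ _ (by simp [Fin.le_def]; omega), Fin.val_succ]
    omega

/-- the four-term recurrence relation for the Cauchy-Jacobi orthogonal
polynomials. -/
theorem four_term_recurrence (s t : ℕ)
    (h₁ : ∀ k, tau s t k ≠ 0) (h₂ : ∀ k, sigT s t k ≠ 0)
    (n : ℕ) (hn : 2 ≤ n) (x : ℝ) :
    x * (P s t n x + acoef s t n * P s t (n - 1) x) =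
      P s t (n + 1) x + (acoef s t n - bcoef s t n) * P s t n x +
        (-ccoef s t n + acoef s t n * bcoef s t (n - 1)) * P s t (n - 1) x -
        acoef s t n * ccoef s t (n - 1) * P s t (n - 2) x := by
  obtain ⟨n, rfl⟩ := Nat.exists_eq_add_of_le' hn
  have ha : momentFunctional (momS s t) (orthoPoly (mom s t) (n + 2)) +
      acoef s t (n + 2) * momentFunctional (momS s t) (orthoPoly (mom s t) (n + 1)) = 0 := by
    rw [momentFunctional_orthoPoly, momentFunctional_orthoPoly, acoef,
      show n + 2 - 1 = n + 1 by omega]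
    have := h₁ (n + 2)
    have := h₁ (n + 1)
    have := h₂ (n + 1)
    field_simp
    ring
  have key := congrArg (Polynomial.eval x) (orthoPoly_four_term (mom_comm s t)
    (mom_succ_add_mom_succ s t) h₁ n (acoef s t (n + 2)) ha)
  simp only [Polynomial.eval_mul, Polynomial.eval_X, Polynomial.eval_add, Polynomial.eval_sub,
    Polynomial.eval_smul, smul_eq_mul, ← P_eq_eval_orthoPoly, ← pcoef_eq_coeff_orthoPoly] at key
  exact key
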